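/- Let G be a graph, O a consistent orientation of a nested set of finite-order separations of G containing no small separations, and Π = ⋂{B : (A,B) ∈ O} its part. Suppose corridors (equivalence classes of the relation (C,D) ∼ (C',D') iff some (U,W) ∈ O is above both) are defined, and for a corridor γ let A_γ = ⋃{C : (C,D) ∈ γ}. Then the sets A_γ \ Π over all corridors γ partition V(G) \ Π: every vertex outside Π lies in A_γ \ Π for exactly one corridor γ. -/

import Mathlib

open Set

variable {V : Type*}

/-- The inverse (swap) of an oriented separation. -/
def swapS (p : Set V × Set V) : Set V × Set V := (p.2, p.1)

/-- The partial order on oriented separations: (A,B) ≤ (C,D) iff A ⊆ C and D ⊆ B. -/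
def sepLe (p q : Set V × Set V) : Prop := p.1 ⊆ q.1 ∧ q.2 ⊆ p.2

/-- Two oriented separations are nested if they have comparable orientations. -/
def NestedPair (p q : Set V × Set V) : Prop :=
  sepLe p q ∨ sepLe q p ∨ sepLe p (swapS q) ∨ sepLe (swapS q) p

/-- A set O of oriented separations is consistent: it contains no two orientations
pointing away from each other, i.e. no p, q of distinct underlying separations
with (swap p) ≤ q. -/
def ConsistentO (O : Set (Set V × Set V)) : Prop :=
  ∀ p ∈ O, ∀ q ∈ O, p ≠ q → p ≠ swapS q → ¬ sepLe (swapS p) q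

/-- The corridor relation on O: related iff some element of O lies above both. -/
def corRel (O : Set (Set V × Set V)) (p q : Set V × Set V) : Prop :=
  ∃ u ∈ O, sepLe p u ∧ sepLe q u

/-- A_γ for the corridor γ of p: the union of the first components of all
elements of O in the corridor of p. -/
def Aset (O : Set (Set V × Set V)) (p : Set V × Set V) : Set V :=
  {v | ∃ q ∈ O, corRel O q p ∧ v ∈ q.1}

/-- The part Π of an orientation O. -/
def partOf (O : Set (Set V × Set V)) : Set V := {v | ∀ p ∈ O, v ∈ p.2}

/-- A separation of the graph G: the two sides cover V and no edge jumps the separator. -/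
def IsGraphSep (G : SimpleGraph V) (p : Set V × Set V) : Prop :=
  p.1 ∪ p.2 = Set.univ ∧ ∀ a ∈ p.1 \ p.2, ∀ b ∈ p.2 \ p.1, ¬ G.Adj a b

/-- The component of G − X containing some vertex v ∉ X, described via walks avoiding X. -/
def ComponentOf (G : SimpleGraph V) (X C : Set V) : Prop :=
  ∃ v, v ∉ X ∧ C = {w | ∃ p : G.Walk v w, ∀ x ∈ p.support, x ∉ X}

/-- The neighbourhood of a vertex set C: vertices outside C adjacent to C. -/
def nbhd (G : SimpleGraph V) (C : Set V) : Set V :=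
  {x | x ∉ C ∧ ∃ c ∈ C, G.Adj x c}

theorem sepLe_refl {V : Type*} (p : Set V × Set V) : sepLe p p :=
  ⟨Subset.rfl, Subset.rfl⟩

theorem sepLe_trans {V : Type*} {p q r : Set V × Set V} (hpq : sepLe p q) (hqr : sepLe q r) :
    sepLe p r :=
  ⟨hpq.1.trans hqr.1, hqr.2.trans hpq.2⟩

theorem corRel_symm {V : Type*} {O : Set (Set V × Set V)} {p q : Set V × Set V}
    (h : corRel O p q) : corRel O q p :=
  let ⟨u, hu, hpu, hqu⟩ := h
  ⟨u, hu, hqu, hpu⟩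

/-- Two nested elements of a consistent orientation are related, unless they point
towards each other. -/
theorem corRel_or_sepLe_swapS {V : Type*} {O : Set (Set V × Set V)}
    (hnested : ∀ p ∈ O, ∀ q ∈ O, NestedPair p q) (hanti : ∀ p ∈ O, swapS p ∉ O)
    (hcons : ConsistentO O) {p q : Set V × Set V} (hp : p ∈ O) (hq : q ∈ O) :
    corRel O p q ∨ sepLe p (swapS q) := by
  rcases hnested p hp q hq with h | h | h | h
  · exact .inl ⟨q, hq, h, sepLe_refl q⟩
  · exact .inl ⟨p, hp, sepLe_refl p, h⟩
  · exact .inr h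
  · by_cases hqp : q = p
    · exact .inl ⟨p, hp, sepLe_refl p, hqp ▸ sepLe_refl q⟩
    · exact absurd h (hcons q hq p hp hqp fun e => hanti p hp (e ▸ hq))

theorem corRel_trans {V : Type*} {O : Set (Set V × Set V)}
    (hnested : ∀ p ∈ O, ∀ q ∈ O, NestedPair p q) (hanti : ∀ p ∈ O, swapS p ∉ O)
    (hcons : ConsistentO O) {p q r : Set V × Set V} (hq : ¬ sepLe q (swapS q))
    (hpq : corRel O p q) (hqr : corRel O q r) : corRel O p r := by
  obtain ⟨u, hu, hpu, hqu⟩ := hpq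
  obtain ⟨w, hw, hqw, hrw⟩ := hqr
  rcases corRel_or_sepLe_swapS hnested hanti hcons hu hw with ⟨x, hx, hux, hwx⟩ | h
  · exact ⟨x, hx, sepLe_trans hpu hux, sepLe_trans hrw hwx⟩
  · have hwq : sepLe (swapS w) (swapS q) := ⟨hqw.2, hqw.1⟩
    exact absurd (sepLe_trans (sepLe_trans hqu h) hwq) hq

/-- The sets A_γ \ Π over all corridors γ of a consistent orientation O of
a nested set of finite-order separations of G (no small separations) partition V(G) \ Π:
every vertex outside Π lies in A_γ for some corridor, and any two corridors whose A-set
contains it coincide. -/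
theorem stmt_6 {V : Type*} (G : SimpleGraph V) (S O : Set (Set V × Set V))
    (hSsep : ∀ p ∈ S, IsGraphSep G p)
    (hSfin : ∀ p ∈ S, (p.1 ∩ p.2).Finite)
    (hSsymm : ∀ p ∈ S, swapS p ∈ S)
    (hSnested : ∀ p ∈ S, ∀ q ∈ S, NestedPair p q)
    (hnosmall : ∀ p ∈ S, ¬ sepLe p (swapS p))
    (hOS : O ⊆ S)
    (horient : ∀ p ∈ S, (p ∈ O ∨ swapS p ∈ O) ∧ ¬ (p ∈ O ∧ swapS p ∈ O))
    (hcons : ConsistentO O) :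
    ∀ v : V, v ∉ partOf O →
      (∃ p ∈ O, v ∈ Aset O p) ∧
      (∀ p ∈ O, ∀ q ∈ O, v ∈ Aset O p → v ∈ Aset O q → corRel O p q) := by
  intro v hv
  have hnested : ∀ p ∈ O, ∀ q ∈ O, NestedPair p q :=
    fun p hp q hq => hSnested p (hOS hp) q (hOS hq)
  have hanti : ∀ p ∈ O, swapS p ∉ O := fun p hp h => (horient p (hOS hp)).2 ⟨hp, h⟩
  have htrans {p q r : Set V × Set V} (hq : q ∈ O) :
      corRel O p q → corRel O q r → corRel O p r :=
    corRel_trans hnested hanti hcons (hnosmall q (hOS hq))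
  obtain ⟨r, hr, hvr⟩ : ∃ r ∈ O, v ∉ r.2 := by simpa [partOf] using hv
  have hrel : ∀ p ∈ O, v ∈ Aset O p → corRel O p r := by
    rintro p - ⟨s, hs, hsp, hvs⟩
    refine htrans hs (corRel_symm hsp) ?_
    exact (corRel_or_sepLe_swapS hnested hanti hcons hs hr).resolve_right
      fun h => hvr (h.1 hvs)
  refine ⟨⟨r, hr, r, hr, ⟨r, hr, sepLe_refl r, sepLe_refl r⟩, ?_⟩, ?_⟩
  · have hcover : v ∈ r.1 ∪ r.2 := (hSsep r (hOS hr)).1 ▸ mem_univ v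
    exact hcover.resolve_right hvr
  · exact fun p hp q hq hvp hvq => htrans hr (hrel p hp hvp) (corRel_symm (hrel q hq hvq))
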